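/- Under (H1), for every bounded measurable g : D×V → [0,∞) there exist constants C₁, C₂ > 0 such that the mild NTE with initial datum g has a solution (ψ_t[g])_{t≥0} satisfying sup_{(r,υ)∈D×V} ψ_t[g](r,υ) ≤ C₁·e^{C₂ t} for all t ≥ 0; moreover, this solution is unique in the class of families of nonnegative measurable functions on D×V that are uniformly bounded on D×V×[0,T] for every T > 0. -/

import Mathlib

open MeasureTheory Set
open scoped ENNReal

noncomputable section

/-- Points/velocities live in `ℝ³`. -/
abbrev Pt : Type := EuclideanSpace ℝ (Fin 3)

/-- The velocity space `V = {υ ∈ ℝ³ : vmin ≤ ‖υ‖ ≤ vmax}`. -/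
def Vel (vmin vmax : ℝ) : Set Pt := {υ : Pt | vmin ≤ ‖υ‖ ∧ ‖υ‖ ≤ vmax}

/-- The exit time `κ_{r,υ} = inf {t > 0 : r + tυ ∉ D}`. -/
def exitTime (D : Set Pt) (r υ : Pt) : ℝ := sInf {t : ℝ | 0 < t ∧ r + t • υ ∉ D}

/-- The advection semigroup `U_t[g](r,υ) = g(r+υt, υ)·1_{t < κ_{r,υ}}`. -/
def advect (D : Set Pt) (g : Pt → Pt → ℝ) (t : ℝ) (r υ : Pt) : ℝ :=
  if t < exitTime D r υ then g (r + t • υ) υ else 0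

/-- The combined backwards scatter-plus-fission operator `(S + F) f`,
extended by zero outside `D × V`. -/
def scatFis (D V : Set Pt) (σs σf : Pt → Pt → ℝ) (πs πf : Pt → Pt → Pt → ℝ)
    (f : Pt → Pt → ℝ) (r υ : Pt) : ℝ :=
  (D ×ˢ V).indicator
    (fun p : Pt × Pt =>
      σs p.1 p.2 * ((∫ υ' in V, f p.1 υ' * πs p.1 p.2 υ') - f p.1 p.2) +
      σf p.1 p.2 * ((∫ υ' in V, f p.1 υ' * πf p.1 p.2 υ') - f p.1 p.2))
    (r, υ)

/-- `g` is a nonnegative, bounded, measurable function on `Pt × Pt` (in curried form). -/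
def BddMeasNN (g : Pt → Pt → ℝ) : Prop :=
  Measurable (Function.uncurry g) ∧ (∀ r υ, 0 ≤ g r υ) ∧ ∃ M : ℝ, ∀ r υ, g r υ ≤ M

/-- `ψ` is a family of nonnegative bounded measurable functions, vanishing off `D × V`,
solving the mild neutron transport equation
`ψ_t[g] = U_t[g] + ∫₀ᵗ U_s[(S+F) ψ_{t-s}[g]] ds` pointwise on `D × V` for all `t ≥ 0`. -/
def IsMildSolution (D V : Set Pt) (σs σf : Pt → Pt → ℝ) (πs πf : Pt → Pt → Pt → ℝ)
    (g : Pt → Pt → ℝ) (ψ : ℝ → Pt → Pt → ℝ) : Prop :=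
  (∀ t : ℝ, Measurable (Function.uncurry (ψ t))) ∧
  (∀ t r υ, 0 ≤ ψ t r υ) ∧
  (∀ t : ℝ, ∃ M : ℝ, ∀ r υ, ψ t r υ ≤ M) ∧
  (∀ t r υ, (r, υ) ∉ D ×ˢ V → ψ t r υ = 0) ∧
  (∀ t : ℝ, 0 ≤ t → ∀ r υ : Pt, (r, υ) ∈ D ×ˢ V →
    ψ t r υ = advect D g t r υ +
      ∫ s in (0:ℝ)..t, advect D (scatFis D V σs σf πs πf (ψ (t - s))) s r υ)

/-- Uniform boundedness on `D × V × [0,T]` for every `T > 0`. -/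
def TimeLocBounded (ψ : ℝ → Pt → Pt → ℝ) : Prop :=
  ∀ T : ℝ, 0 < T → ∃ M : ℝ, ∀ t ∈ Icc (0:ℝ) T, ∀ r υ : Pt, ψ t r υ ≤ M

/-- The standing context of the paper: `D ⊆ ℝ³` nonempty, open, bounded, convex with
Lebesgue-null boundary; `0 < vmin < vmax`; measurable nonnegative cross-sections and
kernels, with `π_s(r,υ,·)` a probability density on `V`; and (H1): all cross-sections
and kernels uniformly bounded. -/
structure NTEContext (D : Set Pt) (vmin vmax : ℝ)
    (σs σf : Pt → Pt → ℝ) (πs πf : Pt → Pt → Pt → ℝ) : Prop where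
  D_nonempty : D.Nonempty
  D_open : IsOpen D
  D_bounded : Bornology.IsBounded D
  D_convex : Convex ℝ D
  D_frontier_null : volume (frontier D) = 0
  vmin_pos : 0 < vmin
  vmin_lt_vmax : vmin < vmax
  σs_meas : Measurable (Function.uncurry σs)
  σf_meas : Measurable (Function.uncurry σf)
  πs_meas : Measurable fun p : Pt × Pt × Pt => πs p.1 p.2.1 p.2.2
  πf_meas : Measurable fun p : Pt × Pt × Pt => πf p.1 p.2.1 p.2.2
  σs_nonneg : ∀ r υ, 0 ≤ σs r υ
  σf_nonneg : ∀ r υ, 0 ≤ σf r υ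
  πs_nonneg : ∀ r υ υ', 0 ≤ πs r υ υ'
  πf_nonneg : ∀ r υ υ', 0 ≤ πf r υ υ'
  πs_prob : ∀ r ∈ D, ∀ υ ∈ Vel vmin vmax, (∫ υ' in Vel vmin vmax, πs r υ υ') = 1
  H1 : ∃ M : ℝ, (∀ r υ, σs r υ ≤ M) ∧ (∀ r υ, σf r υ ≤ M) ∧
        (∀ r υ υ', πs r υ υ' ≤ M) ∧ (∀ r υ υ', πf r υ υ' ≤ M)


open Filter Topology

/-- Joint measurability in time, position and velocity. -/
def JointMeas (Φ : ℝ → Pt → Pt → ℝ) : Prop :=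
  Measurable fun p : ℝ × Pt × Pt => Φ p.1 p.2.1 p.2.2

/-- A measurable, `L`-Lipschitz (in the supremum norm) operator on bounded functions. -/
structure IsLipOp (A : (Pt → Pt → ℝ) → Pt → Pt → ℝ) (L : ℝ) : Prop where
  nonneg : 0 ≤ L
  meas : ∀ Φ : ℝ → Pt → Pt → ℝ, JointMeas Φ → JointMeas fun t => A (Φ t)
  lip : ∀ f₁ f₂ : Pt → Pt → ℝ, ∀ C B : ℝ,
    Measurable (Function.uncurry f₁) → Measurable (Function.uncurry f₂) →
    (∀ r υ, |f₁ r υ| ≤ C) → (∀ r υ, |f₂ r υ| ≤ C) → (∀ r υ, |f₁ r υ - f₂ r υ| ≤ B) →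
    ∀ r υ, |A f₁ r υ - A f₂ r υ| ≤ L * B
  zero : ∀ r υ, A (fun _ _ => 0) r υ = 0

theorem JointMeas.slice {Φ : ℝ → Pt → Pt → ℝ} (h : JointMeas Φ) (t : ℝ) :
    Measurable (Function.uncurry (Φ t)) :=
  h.comp (measurable_const.prodMk measurable_id)

namespace IsLipOp

variable {A : (Pt → Pt → ℝ) → Pt → Pt → ℝ} {L : ℝ}

theorem bound (hA : IsLipOp A L) {f : Pt → Pt → ℝ} {C : ℝ}
    (hf : Measurable (Function.uncurry f)) (hC : ∀ r υ, |f r υ| ≤ C) (r υ : Pt) :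
    |A f r υ| ≤ L * C := by
  have h := hA.lip f (fun _ _ => 0) C C hf measurable_const hC
    (fun r υ => by simpa using (abs_nonneg _).trans (hC r υ)) (by simpa using hC) r υ
  simpa [hA.zero] using h

theorem add_smul (hA : IsLipOp A L) {c : ℝ} (hc : 0 ≤ c) :
    IsLipOp (fun f r υ => A f r υ + c * f r υ) (L + c) where
  nonneg := add_nonneg hA.nonneg hc
  meas Φ hΦ := (hA.meas Φ hΦ).add (measurable_const.mul hΦ)
  lip f₁ f₂ C B h₁ h₂ hC₁ hC₂ hB r υ := by
    have h := hA.lip f₁ f₂ C B h₁ h₂ hC₁ hC₂ hB r υ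
    calc |A f₁ r υ + c * f₁ r υ - (A f₂ r υ + c * f₂ r υ)|
        = |(A f₁ r υ - A f₂ r υ) + c * (f₁ r υ - f₂ r υ)| := by ring_nf
      _ ≤ |A f₁ r υ - A f₂ r υ| + |c * (f₁ r υ - f₂ r υ)| := abs_add_le _ _
      _ ≤ L * B + c * B := by
        rw [abs_mul, abs_of_nonneg hc]
        exact add_le_add h (mul_le_mul_of_nonneg_left (hB r υ) hc)
      _ = (L + c) * B := by ring
  zero r υ := by simp [hA.zero]

theorem measurable_integrand (hA : IsLipOp A L) {Φ : ℝ → Pt → Pt → ℝ} (hΦ : JointMeas Φ) :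
    Measurable fun q : (ℝ × Pt × Pt) × ℝ =>
      A (Φ (q.1.1 - q.2)) (q.1.2.1 + q.2 • q.1.2.2) q.1.2.2 := by
  have hm : Measurable fun q : (ℝ × Pt × Pt) × ℝ =>
      ((q.1.1 - q.2, q.1.2.1 + q.2 • q.1.2.2, q.1.2.2) : ℝ × Pt × Pt) := by fun_prop
  exact (hA.meas Φ hΦ).comp hm

theorem intervalIntegrable (hA : IsLipOp A L) {Φ : ℝ → Pt → Pt → ℝ} (hΦ : JointMeas Φ)
    {C lam : ℝ} (hC : ∀ t r υ, |Φ t r υ| ≤ C * Real.exp (lam * t)) (t a b : ℝ) (r υ : Pt) :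
    IntervalIntegrable (fun s => A (Φ (t - s)) (r + s • υ) υ) volume a b := by
  have hg : Continuous fun s : ℝ => L * (C * Real.exp (lam * (t - s))) := by fun_prop
  refine (hg.intervalIntegrable a b).mono_fun' ?_ ?_
  · exact ((hA.measurable_integrand hΦ).comp
      (measurable_const.prodMk measurable_id : Measurable fun s : ℝ =>
        (((t, r, υ), s) : (ℝ × Pt × Pt) × ℝ))).aestronglyMeasurable
  · exact Eventually.of_forall fun s => hA.bound (hΦ.slice _) (hC (t - s)) _ _

end IsLipOp

/-- The right-hand side of the mild equation, with advected datum `G`. -/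
def duhamel (D V : Set Pt) (A : (Pt → Pt → ℝ) → Pt → Pt → ℝ) (G : Pt → Pt → ℝ)
    (Φ : ℝ → Pt → Pt → ℝ) (t : ℝ) (r υ : Pt) : ℝ :=
  (Ici (0 : ℝ) ×ˢ (D ×ˢ V)).indicator (fun p : ℝ × Pt × Pt =>
    G (p.2.1 + p.1 • p.2.2) p.2.2 +
      ∫ s in (0 : ℝ)..p.1, A (Φ (p.1 - s)) (p.2.1 + s • p.2.2) p.2.2) (t, r, υ)

theorem duhamel_of_mem {D V : Set Pt} {A : (Pt → Pt → ℝ) → Pt → Pt → ℝ} {G : Pt → Pt → ℝ}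
    {Φ : ℝ → Pt → Pt → ℝ} {t : ℝ} {r υ : Pt} (ht : 0 ≤ t) (h : (r, υ) ∈ D ×ˢ V) :
    duhamel D V A G Φ t r υ =
      G (r + t • υ) υ + ∫ s in (0 : ℝ)..t, A (Φ (t - s)) (r + s • υ) υ :=
  indicator_of_mem (show (t, r, υ) ∈ Ici (0 : ℝ) ×ˢ (D ×ˢ V) from ⟨ht, h⟩) _

theorem duhamel_of_not_mem {D V : Set Pt} {A : (Pt → Pt → ℝ) → Pt → Pt → ℝ}
    {G : Pt → Pt → ℝ} {Φ : ℝ → Pt → Pt → ℝ} {t : ℝ} {r υ : Pt}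
    (h : ¬ (0 ≤ t ∧ (r, υ) ∈ D ×ˢ V)) : duhamel D V A G Φ t r υ = 0 :=
  indicator_of_notMem (fun hm => h ⟨hm.1, hm.2⟩) _

section Duhamel

variable {D V : Set Pt} {A : (Pt → Pt → ℝ) → Pt → Pt → ℝ} {L : ℝ} {G : Pt → Pt → ℝ}

theorem duhamel_measurable (hD : MeasurableSet D) (hV : MeasurableSet V) (hA : IsLipOp A L)
    (hG : Measurable (Function.uncurry G)) {Φ : ℝ → Pt → Pt → ℝ} (hΦ : JointMeas Φ) :
    JointMeas (duhamel D V A G Φ) := by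
  have hi : Measurable fun p : ℝ × Pt × Pt =>
      ∫ s, (Ioc (0 : ℝ) p.1).indicator
        (fun s => A (Φ (p.1 - s)) (p.2.1 + s • p.2.2) p.2.2) s := by
    refine (StronglyMeasurable.integral_prod_right (Measurable.stronglyMeasurable ?_)).measurable
    have hs : MeasurableSet {q : (ℝ × Pt × Pt) × ℝ | 0 < q.2 ∧ q.2 ≤ q.1.1} :=
      (measurableSet_lt measurable_const measurable_snd).inter
        (measurableSet_le measurable_snd (by fun_prop))
    exact (hA.measurable_integrand hΦ).indicator hs
  have hg : Measurable fun p : ℝ × Pt × Pt => G (p.2.1 + p.1 • p.2.2) p.2.2 :=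
    hG.comp (by fun_prop : Measurable fun p : ℝ × Pt × Pt => (p.2.1 + p.1 • p.2.2, p.2.2))
  have hS : MeasurableSet (Ici (0 : ℝ) ×ˢ (D ×ˢ V)) := measurableSet_Ici.prod (hD.prod hV)
  have heq : (fun p : ℝ × Pt × Pt => duhamel D V A G Φ p.1 p.2.1 p.2.2) =
      (Ici (0 : ℝ) ×ˢ (D ×ˢ V)).indicator (fun p => G (p.2.1 + p.1 • p.2.2) p.2.2 +
        ∫ s, (Ioc (0 : ℝ) p.1).indicator
          (fun s => A (Φ (p.1 - s)) (p.2.1 + s • p.2.2) p.2.2) s) := by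
    funext p
    obtain ⟨t, r, υ⟩ := p
    by_cases h : 0 ≤ t ∧ (r, υ) ∈ D ×ˢ V
    · rw [duhamel_of_mem h.1 h.2, indicator_of_mem
        (show (t, r, υ) ∈ Ici (0 : ℝ) ×ˢ (D ×ˢ V) from ⟨h.1, h.2⟩),
        integral_indicator measurableSet_Ioc, intervalIntegral.integral_of_le h.1]
    · rw [duhamel_of_not_mem h, indicator_of_notMem (fun hm => h ⟨hm.1, hm.2⟩)]
  unfold JointMeas
  rw [heq]
  exact (hg.add hi).indicator hS

theorem duhamel_contract (hA : IsLipOp A L) {lam C B : ℝ} (hlam : 0 < lam)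
    (hL : 2 * L ≤ lam) {Φ₁ Φ₂ : ℝ → Pt → Pt → ℝ} (h₁ : JointMeas Φ₁) (h₂ : JointMeas Φ₂)
    (hC₁ : ∀ t r υ, |Φ₁ t r υ| ≤ C * Real.exp (lam * t))
    (hC₂ : ∀ t r υ, |Φ₂ t r υ| ≤ C * Real.exp (lam * t))
    (hB : ∀ t r υ, |Φ₁ t r υ - Φ₂ t r υ| ≤ B * Real.exp (lam * t)) (t : ℝ) (r υ : Pt) :
    |duhamel D V A G Φ₁ t r υ - duhamel D V A G Φ₂ t r υ| ≤ B / 2 * Real.exp (lam * t) := by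
  have hB0 : 0 ≤ B := by simpa using (abs_nonneg _).trans (hB 0 0 0)
  by_cases h : 0 ≤ t ∧ (r, υ) ∈ D ×ˢ V
  · rw [duhamel_of_mem h.1 h.2, duhamel_of_mem h.1 h.2, add_sub_add_left_eq_sub,
      ← intervalIntegral.integral_sub (hA.intervalIntegrable h₁ hC₁ _ _ _ _ _)
        (hA.intervalIntegrable h₂ hC₂ _ _ _ _ _)]
    have hg : Continuous fun s : ℝ => L * (B * Real.exp (lam * (t - s))) := by fun_prop
    have hder : ∀ s ∈ uIcc 0 t, HasDerivAt
        (fun s => -(L * B / lam) * Real.exp (lam * (t - s)))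
        (L * (B * Real.exp (lam * (t - s)))) s := by
      intro s _
      have h1 : HasDerivAt (fun s : ℝ => lam * (t - s)) (lam * (-1)) s :=
        ((hasDerivAt_id s).const_sub t).const_mul lam
      have h2 := h1.exp.const_mul (-(L * B / lam))
      refine h2.congr_deriv ?_
      have := hlam.ne'
      field_simp
    have hle := intervalIntegral.norm_integral_le_of_norm_le (μ := volume) (b := t) h.1
      (g := fun s => L * (B * Real.exp (lam * (t - s))))
      (f := fun s => A (Φ₁ (t - s)) (r + s • υ) υ - A (Φ₂ (t - s)) (r + s • υ) υ)
      (Eventually.of_forall fun s _ => hA.lip _ _ _ _ (h₁.slice _) (h₂.slice _)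
        (hC₁ (t - s)) (hC₂ (t - s)) (hB (t - s)) _ _) (hg.intervalIntegrable 0 t)
    rw [intervalIntegral.integral_eq_sub_of_hasDerivAt hder (hg.intervalIntegrable 0 t)] at hle
    refine hle.trans ?_
    have hq : L * B / lam ≤ B / 2 := by
      rw [div_le_div_iff₀ hlam two_pos]
      nlinarith
    have hq0 : 0 ≤ L * B / lam := div_nonneg (mul_nonneg hA.nonneg hB0) hlam.le
    simp only [sub_self, mul_zero, Real.exp_zero, sub_zero]
    nlinarith [Real.exp_pos (lam * t)]
  · rw [duhamel_of_not_mem h, duhamel_of_not_mem h]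
    simpa using by positivity

theorem duhamel_zero_bound (hA : IsLipOp A L) {M lam : ℝ} (hlam : 0 < lam)
    (hM : ∀ r υ, |G r υ| ≤ M) (t : ℝ) (r υ : Pt) :
    |duhamel D V A G (fun _ _ _ => 0) t r υ| ≤ M * Real.exp (lam * t) := by
  have hM0 : 0 ≤ M := (abs_nonneg _).trans (hM 0 0)
  by_cases h : 0 ≤ t ∧ (r, υ) ∈ D ×ˢ V
  · rw [duhamel_of_mem h.1 h.2]
    simp only [hA.zero, intervalIntegral.integral_zero, add_zero]
    exact (hM _ _).trans
      (le_mul_of_one_le_right hM0 (Real.one_le_exp (mul_nonneg hlam.le h.1)))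
  · rw [duhamel_of_not_mem h]
    simpa using mul_nonneg hM0 (Real.exp_pos (lam * t)).le

theorem duhamel_bound (hA : IsLipOp A L) {M lam : ℝ} (hlam : 0 < lam) (hL : 2 * L ≤ lam)
    (hM : ∀ r υ, |G r υ| ≤ M) {Φ : ℝ → Pt → Pt → ℝ} (hΦ : JointMeas Φ)
    (hC : ∀ t r υ, |Φ t r υ| ≤ 2 * M * Real.exp (lam * t)) (t : ℝ) (r υ : Pt) :
    |duhamel D V A G Φ t r υ| ≤ 2 * M * Real.exp (lam * t) := by
  have hM0 : 0 ≤ M := (abs_nonneg _).trans (hM 0 0)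
  have h1 := duhamel_contract (D := D) (V := V) (G := G) hA hlam hL hΦ
    (Φ₂ := fun _ _ _ => 0) measurable_const hC
    (fun t r υ => by rw [abs_zero]; positivity) (by simpa using hC) t r υ
  have h2 := duhamel_zero_bound (D := D) (V := V) hA hlam hM t r υ
  calc |duhamel D V A G Φ t r υ|
      = |(duhamel D V A G Φ t r υ - duhamel D V A G (fun _ _ _ => 0) t r υ) +
          duhamel D V A G (fun _ _ _ => 0) t r υ| := by ring_nf
    _ ≤ 2 * M / 2 * Real.exp (lam * t) + M * Real.exp (lam * t) :=
      (abs_add_le _ _).trans (add_le_add h1 h2)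
    _ = 2 * M * Real.exp (lam * t) := by ring

theorem duhamel_nonneg (hpos : ∀ f : Pt → Pt → ℝ, (∀ r υ, 0 ≤ f r υ) → ∀ r υ, 0 ≤ A f r υ)
    (hG : ∀ r υ, 0 ≤ G r υ) {Φ : ℝ → Pt → Pt → ℝ} (hΦ : ∀ t r υ, 0 ≤ Φ t r υ)
    (t : ℝ) (r υ : Pt) : 0 ≤ duhamel D V A G Φ t r υ := by
  by_cases h : 0 ≤ t ∧ (r, υ) ∈ D ×ˢ V
  · rw [duhamel_of_mem h.1 h.2]
    exact add_nonneg (hG _ _)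
      (intervalIntegral.integral_nonneg h.1 fun s _ => hpos _ (hΦ (t - s)) _ _)
  · rw [duhamel_of_not_mem h]

/-- Existence of a nonnegative fixed point of the Duhamel map, by Picard iteration. -/
theorem exists_duhamel_fixedPoint (hD : MeasurableSet D) (hV : MeasurableSet V)
    (hA : IsLipOp A L)
    (hpos : ∀ f : Pt → Pt → ℝ, (∀ r υ, 0 ≤ f r υ) → ∀ r υ, 0 ≤ A f r υ)
    (hGm : Measurable (Function.uncurry G)) (hG : ∀ r υ, 0 ≤ G r υ) {M lam : ℝ}
    (hM : ∀ r υ, |G r υ| ≤ M) (hlam : 0 < lam) (hL : 2 * L ≤ lam) :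
    ∃ φ : ℝ → Pt → Pt → ℝ, JointMeas φ ∧ (∀ t r υ, 0 ≤ φ t r υ) ∧
      (∀ t r υ, |φ t r υ| ≤ 2 * M * Real.exp (lam * t)) ∧ duhamel D V A G φ = φ := by
  have hM0 : 0 ≤ M := (abs_nonneg _).trans (hM 0 0)
  let Φ : ℕ → ℝ → Pt → Pt → ℝ := fun n => (duhamel D V A G)^[n] (fun _ _ _ => 0)
  have hsucc : ∀ n, Φ (n + 1) = duhamel D V A G (Φ n) := fun n =>
    Function.iterate_succ_apply' _ _ _
  have hmeas : ∀ n, JointMeas (Φ n) := by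
    intro n
    induction n with
    | zero => exact measurable_const
    | succ n ih => rw [hsucc]; exact duhamel_measurable hD hV hA hGm ih
  have hnn : ∀ n t r υ, 0 ≤ Φ n t r υ := by
    intro n
    induction n with
    | zero => intro t r υ; exact le_rfl
    | succ n ih => rw [hsucc]; exact duhamel_nonneg hpos hG ih
  have hbd : ∀ n t r υ, |Φ n t r υ| ≤ 2 * M * Real.exp (lam * t) := by
    intro n
    induction n with
    | zero => intro t r υ; simpa [Φ] using by positivity
    | succ n ih => rw [hsucc]; exact duhamel_bound hA hlam hL hM (hmeas n) ih
  have hdiff : ∀ n t r υ,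
      |Φ n t r υ - Φ (n + 1) t r υ| ≤ M * (1 / 2) ^ n * Real.exp (lam * t) := by
    intro n
    induction n with
    | zero =>
      intro t r υ
      simpa [Φ] using duhamel_zero_bound (D := D) (V := V) hA hlam hM t r υ
    | succ n ih =>
      intro t r υ
      rw [hsucc (n + 1)]
      nth_rw 1 [hsucc n]
      have := duhamel_contract (D := D) (V := V) (G := G) hA hlam hL (hmeas n)
        (hmeas (n + 1)) (hbd n) (hbd (n + 1)) ih t r υ
      calc _ ≤ _ := this
        _ = _ := by ring
  have hgeom : ∀ t r υ n, dist (Φ n t r υ) (Φ (n + 1) t r υ) ≤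
      (M * Real.exp (lam * t)) * (1 / 2) ^ n := by
    intro t r υ n
    rw [Real.dist_eq]
    calc _ ≤ _ := hdiff n t r υ
      _ = _ := by ring
  have hlim : ∀ t r υ, ∃ x, Tendsto (fun n => Φ n t r υ) atTop (𝓝 x) := fun t r υ =>
    cauchySeq_tendsto_of_complete
      (cauchySeq_of_le_geometric (1 / 2) _ (by norm_num) (hgeom t r υ))
  choose φ hφ using hlim
  have hφm : JointMeas φ := measurable_of_tendsto_metrizable hmeas
    (tendsto_pi_nhds.2 fun p => hφ p.1 p.2.1 p.2.2)
  have hφb : ∀ t r υ, |φ t r υ| ≤ 2 * M * Real.exp (lam * t) := fun t r υ =>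
    le_of_tendsto (hφ t r υ).abs (Eventually.of_forall fun n => hbd n t r υ)
  have herr : ∀ n t r υ,
      |Φ n t r υ - φ t r υ| ≤ 2 * M * (1 / 2) ^ n * Real.exp (lam * t) := by
    intro n t r υ
    have := dist_le_of_le_geometric_of_tendsto (1 / 2) _ (by norm_num) (hgeom t r υ)
      (hφ t r υ) n
    rw [Real.dist_eq] at this
    calc _ ≤ _ := this
      _ = _ := by ring
  refine ⟨φ, hφm, fun t r υ => ge_of_tendsto' (hφ t r υ) fun n => hnn n t r υ, hφb, ?_⟩
  funext t r υ
  refine tendsto_nhds_unique ?_ ((hφ t r υ).comp (tendsto_add_atTop_nat 1))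
  rw [tendsto_iff_dist_tendsto_zero]
  refine squeeze_zero (fun _ => dist_nonneg) (fun n => ?_)
    (g := fun n : ℕ => (M * Real.exp (lam * t)) * (1 / 2) ^ n) ?_
  · have := duhamel_contract (D := D) (V := V) (G := G) hA hlam hL (hmeas n) hφm (hbd n) hφb
      (herr n) t r υ
    simp only [Function.comp_apply, hsucc, Real.dist_eq]
    calc _ ≤ _ := this
      _ = _ := by ring
  · simpa using (tendsto_pow_atTop_nhds_zero_of_lt_one (r := (1 / 2 : ℝ)) (by norm_num)
      (by norm_num)).const_mul (M * Real.exp (lam * t))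

/-- Two bounded measurable functions satisfying the mild equation on `(0, T]` coincide. -/
theorem duhamel_unique (hA : IsLipOp A L) {T C lam : ℝ} (hlam : 0 < lam) (hL : 2 * L ≤ lam)
    {φ₁ φ₂ : ℝ → Pt → Pt → ℝ} (h₁ : JointMeas φ₁) (h₂ : JointMeas φ₂)
    (hC₁ : ∀ t r υ, |φ₁ t r υ| ≤ C * Real.exp (lam * t))
    (hC₂ : ∀ t r υ, |φ₂ t r υ| ≤ C * Real.exp (lam * t))
    (he₁ : ∀ t ∈ Ioc 0 T, ∀ r υ, φ₁ t r υ = duhamel D V A G φ₁ t r υ)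
    (he₂ : ∀ t ∈ Ioc 0 T, ∀ r υ, φ₂ t r υ = duhamel D V A G φ₂ t r υ)
    (hz : ∀ t ∉ Ioc 0 T, ∀ r υ, φ₁ t r υ = φ₂ t r υ) : φ₁ = φ₂ := by
  have hC0 : 0 ≤ C := by simpa using (abs_nonneg _).trans (hC₁ 0 0 0)
  have key : ∀ n : ℕ, ∀ t r υ,
      |φ₁ t r υ - φ₂ t r υ| ≤ 2 * C * (1 / 2) ^ n * Real.exp (lam * t) := by
    intro n
    induction n with
    | zero =>
      intro t r υ
      calc _ ≤ |φ₁ t r υ| + |φ₂ t r υ| := abs_sub _ _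
        _ ≤ _ := add_le_add (hC₁ t r υ) (hC₂ t r υ)
        _ = _ := by ring
    | succ n ih =>
      intro t r υ
      by_cases ht : t ∈ Ioc 0 T
      · rw [he₁ t ht, he₂ t ht]
        calc _ ≤ _ := duhamel_contract hA hlam hL h₁ h₂ hC₁ hC₂ ih t r υ
          _ = _ := by ring
      · rw [hz t ht]
        simpa using by positivity
  funext t r υ
  have hlim : Tendsto (fun n : ℕ => 2 * C * (1 / 2 : ℝ) ^ n * Real.exp (lam * t)) atTop
      (𝓝 0) := by
    simpa using ((tendsto_pow_atTop_nhds_zero_of_lt_one (r := (1 / 2 : ℝ)) (by norm_num)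
      (by norm_num)).const_mul (2 * C)).mul_const (Real.exp (lam * t))
  have := ge_of_tendsto' hlim fun n => key n t r υ
  exact sub_eq_zero.1 (abs_nonpos_iff.1 this)

end Duhamel

section Geometry

variable {D : Set Pt}

theorem Convex.ray_mem_of_le (hD : Convex ℝ D) {r υ : Pt} {s t : ℝ} (hr : r ∈ D)
    (ht : r + t • υ ∈ D) (hs : 0 ≤ s) (hst : s ≤ t) : r + s • υ ∈ D := by
  rcases hs.eq_or_lt with rfl | hs'
  · simpa using hr
  have ht0 : 0 < t := hs'.trans_le hst
  have h := hD.add_smul_mem hr ht (t := s / t) ⟨by positivity, (div_le_one ht0).2 hst⟩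
  rwa [smul_smul, div_mul_cancel₀ _ ht0.ne'] at h

theorem lt_exitTime_iff (hc : Convex ℝ D) (ho : IsOpen D) (hb : Bornology.IsBounded D)
    {r υ : Pt} {s : ℝ} (hr : r ∈ D) (hυ : υ ≠ 0) (hs : 0 ≤ s) :
    s < exitTime D r υ ↔ r + s • υ ∈ D := by
  have hbdd : BddBelow {t : ℝ | 0 < t ∧ r + t • υ ∉ D} := ⟨0, fun t ht => ht.1.le⟩
  constructor
  · intro h
    rcases hs.eq_or_lt with rfl | hs'
    · simpa using hr
    by_contra hn
    exact absurd h (not_lt.2 (csInf_le hbdd ⟨hs', hn⟩))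
  · intro h
    have hne : {t : ℝ | 0 < t ∧ r + t • υ ∉ D}.Nonempty := by
      obtain ⟨R, hR⟩ := hb.exists_norm_le
      have hυ0 : 0 < ‖υ‖ := norm_pos_iff.2 hυ
      have hR0 : 0 ≤ R := (norm_nonneg _).trans (hR r hr)
      refine ⟨(2 * R + 1) / ‖υ‖, by positivity, fun hmem => ?_⟩
      have h1 := hR _ hmem
      have h2 := hR r hr
      have h3 : ‖((2 * R + 1) / ‖υ‖) • υ‖ = 2 * R + 1 := by
        rw [norm_smul, Real.norm_of_nonneg (by positivity), div_mul_cancel₀ _ hυ0.ne']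
      have h4 : ‖((2 * R + 1) / ‖υ‖) • υ‖ ≤ ‖r + ((2 * R + 1) / ‖υ‖) • υ‖ + ‖r‖ := by
        calc _ = ‖(r + ((2 * R + 1) / ‖υ‖) • υ) - r‖ := by rw [add_sub_cancel_left]
          _ ≤ _ := norm_sub_le _ _
      linarith
    have hcont : Continuous fun t : ℝ => r + t • υ := by fun_prop
    obtain ⟨ε, hε, hball⟩ := Metric.isOpen_iff.1 (ho.preimage hcont) s h
    have hmem : r + (s + ε / 2) • υ ∈ D := by
      refine hball ?_
      rw [Metric.mem_ball, Real.dist_eq, add_sub_cancel_left, abs_of_pos (half_pos hε)]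
      exact half_lt_self hε
    refine lt_of_lt_of_le (by linarith : s < s + ε / 2) (le_csInf hne fun t ht => ?_)
    by_contra hlt
    exact ht.2 (hc.ray_mem_of_le hr hmem ht.1.le (not_le.1 hlt).le)

theorem measurableSet_Vel (a b : ℝ) : MeasurableSet (Vel a b) :=
  (measurableSet_le measurable_const measurable_norm).inter
    (measurableSet_le measurable_norm measurable_const)

theorem volume_Vel_lt_top (a b : ℝ) : volume (Vel a b) < ∞ := by
  refine (measure_mono (t := Metric.closedBall 0 b) fun υ hυ => ?_).trans_lt
    measure_closedBall_lt_top
  simpa using hυ.2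

end Geometry

section Collision

variable {V : Set Pt} {M : ℝ}

theorem collision_lip (hfin : volume V < ∞) {p f₁ f₂ : Pt → ℝ}
    {σ C B x₁ x₂ : ℝ} (hp : Measurable p) (hp0 : ∀ υ, 0 ≤ p υ) (hpM : ∀ υ, p υ ≤ M)
    (hσ0 : 0 ≤ σ) (hσM : σ ≤ M) (h₁ : Measurable f₁) (h₂ : Measurable f₂)
    (hC₁ : ∀ υ, |f₁ υ| ≤ C) (hC₂ : ∀ υ, |f₂ υ| ≤ C) (hB : ∀ υ, |f₁ υ - f₂ υ| ≤ B)
    (hx : |x₁ - x₂| ≤ B) :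
    |σ * ((∫ υ in V, f₁ υ * p υ) - x₁) - σ * ((∫ υ in V, f₂ υ * p υ) - x₂)| ≤
      M * (M * volume.real V + 1) * B := by
  have hB0 : 0 ≤ B := (abs_nonneg _).trans hx
  have hint : ∀ f : Pt → ℝ, Measurable f → (∀ υ, |f υ| ≤ C) →
      IntegrableOn (fun υ => f υ * p υ) V := by
    intro f hf hfC
    refine Measure.integrableOn_of_bounded (M := C * M) hfin.ne
      (hf.mul hp).aestronglyMeasurable (Eventually.of_forall fun υ => ?_)
    rw [norm_mul, Real.norm_eq_abs, Real.norm_of_nonneg (hp0 υ)]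
    exact mul_le_mul (hfC υ) (hpM υ) (hp0 υ) ((abs_nonneg _).trans (hfC υ))
  have hI : |(∫ υ in V, f₁ υ * p υ) - ∫ υ in V, f₂ υ * p υ| ≤ B * M * volume.real V := by
    rw [← integral_sub (hint f₁ h₁ hC₁) (hint f₂ h₂ hC₂), ← Real.norm_eq_abs]
    refine norm_setIntegral_le_of_norm_le_const hfin fun υ _ => ?_
    rw [← sub_mul, norm_mul, Real.norm_eq_abs, Real.norm_of_nonneg (hp0 υ)]
    exact mul_le_mul (hB υ) (hpM υ) (hp0 υ) hB0
  rw [← mul_sub, abs_mul, abs_of_nonneg hσ0, mul_assoc]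
  refine mul_le_mul hσM ?_ (abs_nonneg _) (hσ0.trans hσM)
  calc _ = |((∫ υ in V, f₁ υ * p υ) - ∫ υ in V, f₂ υ * p υ) - (x₁ - x₂)| := by ring_nf
    _ ≤ _ := abs_sub _ _
    _ ≤ _ := add_le_add hI hx
    _ = _ := by ring

theorem collision_measurable {σ : Pt → Pt → ℝ} {p : Pt → Pt → Pt → ℝ}
    (hσ : Measurable (Function.uncurry σ))
    (hp : Measurable fun q : Pt × Pt × Pt => p q.1 q.2.1 q.2.2)
    {Φ : ℝ → Pt → Pt → ℝ} (hΦ : JointMeas Φ) :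
    Measurable fun q : ℝ × Pt × Pt =>
      σ q.2.1 q.2.2 * ((∫ υ' in V, Φ q.1 q.2.1 υ' * p q.2.1 q.2.2 υ') - Φ q.1 q.2.1 q.2.2) := by
  have hi : Measurable fun q : ℝ × Pt × Pt => ∫ υ' in V, Φ q.1 q.2.1 υ' * p q.2.1 q.2.2 υ' := by
    refine (StronglyMeasurable.integral_prod_right (Measurable.stronglyMeasurable ?_)).measurable
    have h1 : Measurable fun q : (ℝ × Pt × Pt) × Pt => ((q.1.1, q.1.2.1, q.2) : ℝ × Pt × Pt) := by
      fun_prop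
    have h2 : Measurable fun q : (ℝ × Pt × Pt) × Pt =>
        ((q.1.2.1, q.1.2.2, q.2) : Pt × Pt × Pt) := by fun_prop
    exact (hΦ.comp h1).mul (hp.comp h2)
  exact (hσ.comp measurable_snd).mul (hi.sub hΦ)

end Collision

section ScatFis

variable {D V : Set Pt} {σs σf : Pt → Pt → ℝ} {πs πf : Pt → Pt → Pt → ℝ}

theorem scatFis_of_mem {f : Pt → Pt → ℝ} {r υ : Pt} (h : (r, υ) ∈ D ×ˢ V) :
    scatFis D V σs σf πs πf f r υ =
      σs r υ * ((∫ υ' in V, f r υ' * πs r υ υ') - f r υ) +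
      σf r υ * ((∫ υ' in V, f r υ' * πf r υ υ') - f r υ) :=
  indicator_of_mem h _

theorem scatFis_of_not_mem {f : Pt → Pt → ℝ} {r υ : Pt} (h : (r, υ) ∉ D ×ˢ V) :
    scatFis D V σs σf πs πf f r υ = 0 :=
  indicator_of_notMem h _

theorem scatFis_const_mul (a : ℝ) (f : Pt → Pt → ℝ) (r υ : Pt) :
    scatFis D V σs σf πs πf (fun r υ => a * f r υ) r υ =
      a * scatFis D V σs σf πs πf f r υ := by
  by_cases h : (r, υ) ∈ D ×ˢ V
  · simp only [scatFis_of_mem h, mul_assoc a, integral_const_mul]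
    ring
  · simp only [scatFis_of_not_mem h, mul_zero]

theorem scatFis_isLipOp {M : ℝ} (hM : 0 ≤ M) (hD : MeasurableSet D) (hV : MeasurableSet V)
    (hfin : volume V < ∞)
    (hσs : Measurable (Function.uncurry σs)) (hσf : Measurable (Function.uncurry σf))
    (hπs : Measurable fun p : Pt × Pt × Pt => πs p.1 p.2.1 p.2.2)
    (hπf : Measurable fun p : Pt × Pt × Pt => πf p.1 p.2.1 p.2.2)
    (hσs0 : ∀ r υ, 0 ≤ σs r υ) (hσf0 : ∀ r υ, 0 ≤ σf r υ)
    (hπs0 : ∀ r υ υ', 0 ≤ πs r υ υ') (hπf0 : ∀ r υ υ', 0 ≤ πf r υ υ')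
    (hσsM : ∀ r υ, σs r υ ≤ M) (hσfM : ∀ r υ, σf r υ ≤ M)
    (hπsM : ∀ r υ υ', πs r υ υ' ≤ M) (hπfM : ∀ r υ υ', πf r υ υ' ≤ M) :
    IsLipOp (scatFis D V σs σf πs πf) (2 * (M * (M * volume.real V + 1))) where
  nonneg := by positivity
  meas Φ hΦ :=
    ((collision_measurable hσs hπs hΦ).add (collision_measurable hσf hπf hΦ)).indicator
      (measurable_snd (hD.prod hV))
  lip f₁ f₂ C B h₁ h₂ hC₁ hC₂ hB r υ := by
    have hB0 : 0 ≤ B := (abs_nonneg _).trans (hB r υ)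
    by_cases h : (r, υ) ∈ D ×ˢ V
    · rw [scatFis_of_mem h, scatFis_of_mem h]
      have hm : ∀ f : Pt → Pt → ℝ, Measurable (Function.uncurry f) → Measurable (f r) :=
        fun f hf => hf.comp measurable_prodMk_left
      have hmk : ∀ p : Pt → Pt → Pt → ℝ,
          (Measurable fun q : Pt × Pt × Pt => p q.1 q.2.1 q.2.2) → Measurable (p r υ) :=
        fun p hp => hp.comp (measurable_prodMk_left.comp measurable_prodMk_left)
      have e₁ := collision_lip hfin (hmk πs hπs) (hπs0 r υ) (hπsM r υ) (hσs0 r υ)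
        (hσsM r υ) (hm f₁ h₁) (hm f₂ h₂) (hC₁ r) (hC₂ r) (hB r) (hB r υ)
      have e₂ := collision_lip hfin (hmk πf hπf) (hπf0 r υ) (hπfM r υ) (hσf0 r υ)
        (hσfM r υ) (hm f₁ h₁) (hm f₂ h₂) (hC₁ r) (hC₂ r) (hB r) (hB r υ)
      rw [add_sub_add_comm]
      calc _ ≤ _ := abs_add_le _ _
        _ ≤ _ := add_le_add e₁ e₂
        _ = _ := by ring
    · rw [scatFis_of_not_mem h, scatFis_of_not_mem h, sub_zero, abs_zero]
      positivity
  zero r υ := by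
    by_cases h : (r, υ) ∈ D ×ˢ V
    · simp [scatFis_of_mem h]
    · exact scatFis_of_not_mem h

theorem scatFis_add_nonneg {M : ℝ} (hM : 0 ≤ M)
    (hσs0 : ∀ r υ, 0 ≤ σs r υ) (hσf0 : ∀ r υ, 0 ≤ σf r υ)
    (hπs0 : ∀ r υ υ', 0 ≤ πs r υ υ') (hπf0 : ∀ r υ υ', 0 ≤ πf r υ υ')
    (hσsM : ∀ r υ, σs r υ ≤ M) (hσfM : ∀ r υ, σf r υ ≤ M) {f : Pt → Pt → ℝ}
    (hf : ∀ r υ, 0 ≤ f r υ) (r υ : Pt) :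
    0 ≤ scatFis D V σs σf πs πf f r υ + 2 * M * f r υ := by
  have hfr := hf r υ
  by_cases h : (r, υ) ∈ D ×ˢ V
  · rw [scatFis_of_mem h]
    have i₁ : 0 ≤ ∫ υ' in V, f r υ' * πs r υ υ' :=
      integral_nonneg fun υ' => mul_nonneg (hf r υ') (hπs0 r υ υ')
    have i₂ : 0 ≤ ∫ υ' in V, f r υ' * πf r υ υ' :=
      integral_nonneg fun υ' => mul_nonneg (hf r υ') (hπf0 r υ υ')
    nlinarith [mul_nonneg (hσs0 r υ) i₁, mul_nonneg (hσf0 r υ) i₂,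
      mul_nonneg (sub_nonneg.2 (hσsM r υ)) hfr, mul_nonneg (sub_nonneg.2 (hσfM r υ)) hfr]
  · rw [scatFis_of_not_mem h]
    positivity

theorem advect_scatFis (hc : Convex ℝ D) (ho : IsOpen D) (hb : Bornology.IsBounded D)
    {f : Pt → Pt → ℝ} {r υ : Pt} {s : ℝ} (hr : r ∈ D) (hυ : υ ≠ 0) (hs : 0 ≤ s) :
    advect D (scatFis D V σs σf πs πf f) s r υ =
      scatFis D V σs σf πs πf f (r + s • υ) υ := by
  unfold advect
  split_ifs with h
  · rfl
  · rw [lt_exitTime_iff hc ho hb hr hυ hs] at h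
    exact (scatFis_of_not_mem fun hm => h hm.1).symm

end ScatFis

section Integration

/-- The Bochner integral of a bounded function depends continuously on its lower limit at `0`,
even when the function is not measurable. -/
theorem tendsto_integral_lower {k : ℝ → ℝ} {K t : ℝ} (ht : 0 < t)
    (hK : ∀ s ∈ Icc 0 t, |k s| ≤ K) :
    Tendsto (fun s => ∫ x in s..t, k x) (𝓝[>] 0) (𝓝 (∫ x in (0 : ℝ)..t, k x)) := by
  by_cases h : IntervalIntegrable k volume 0 t
  · rw [tendsto_iff_dist_tendsto_zero]
    have hlim : Tendsto (fun s : ℝ => K * s) (𝓝[>] 0) (𝓝 0) := by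
      have : Tendsto (fun s : ℝ => K * s) (𝓝 0) (𝓝 (K * 0)) := tendsto_id.const_mul K
      rw [mul_zero] at this
      exact this.mono_left nhdsWithin_le_nhds
    refine squeeze_zero' (Eventually.of_forall fun _ => dist_nonneg) ?_ hlim
    filter_upwards [Ioo_mem_nhdsGT ht] with s hs
    have h0s : IntervalIntegrable k volume 0 s :=
      h.mono_set (uIcc_subset_uIcc left_mem_uIcc (by
        rw [uIcc_of_le ht.le]; exact ⟨hs.1.le, hs.2.le⟩))
    have hst : IntervalIntegrable k volume s t :=
      h.mono_set (uIcc_subset_uIcc (by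
        rw [uIcc_of_le ht.le]; exact ⟨hs.1.le, hs.2.le⟩) right_mem_uIcc)
    rw [← intervalIntegral.integral_add_adjacent_intervals h0s hst, dist_comm, Real.dist_eq,
      add_sub_cancel_right, ← Real.norm_eq_abs]
    have := intervalIntegral.norm_integral_le_of_norm_le_const (a := 0) (b := s) (f := k)
      (C := K) (fun x hx => by
        rw [uIoc_of_le hs.1.le] at hx
        exact hK x ⟨hx.1.le, hx.2.trans hs.2.le⟩)
    rwa [sub_zero, abs_of_pos hs.1] at this
  · have hex : ∃ s₀, 0 < s₀ ∧ s₀ ≤ t ∧ ¬ IntervalIntegrable k volume s₀ t := by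
      by_contra hcon
      push Not at hcon
      refine h ?_
      have hU : Ioc 0 t = ⋃ n : ℕ, Ioc (t / (n + 1)) t := by
        ext x
        simp only [mem_iUnion, mem_Ioc]
        constructor
        · rintro ⟨hx0, hxt⟩
          obtain ⟨n, hn⟩ := exists_nat_gt (t / x)
          refine ⟨n, ?_, hxt⟩
          rw [div_lt_iff₀ hx0] at hn
          rw [div_lt_iff₀ (by positivity)]
          nlinarith
        · rintro ⟨n, hx, hxt⟩
          exact ⟨lt_trans (by positivity) hx, hxt⟩
      have hm : AEStronglyMeasurable k (volume.restrict (Ioc 0 t)) := by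
        rw [hU, aestronglyMeasurable_iUnion_iff]
        intro n
        have hle : t / (n + 1) ≤ t :=
          div_le_self ht.le (by linarith [(Nat.cast_nonneg n : (0 : ℝ) ≤ n)])
        exact ((intervalIntegrable_iff_integrableOn_Ioc_of_le hle).1
          (hcon _ (by positivity) hle)).aestronglyMeasurable
      rw [intervalIntegrable_iff_integrableOn_Ioc_of_le ht.le]
      refine Integrable.of_bound hm K ?_
      filter_upwards [ae_restrict_mem measurableSet_Ioc] with x hx
      exact hK x ⟨hx.1.le, hx.2⟩
    obtain ⟨s₀, hs₀, hs₀t, hn⟩ := hex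
    rw [intervalIntegral.integral_undef h]
    refine Tendsto.congr' ?_ tendsto_const_nhds
    filter_upwards [Ioo_mem_nhdsGT hs₀] with s hs
    refine (intervalIntegral.integral_undef fun hi => hn (hi.mono_set ?_)).symm
    refine uIcc_subset_uIcc ?_ right_mem_uIcc
    rw [uIcc_of_le (hs.2.le.trans hs₀t)]
    exact ⟨hs.2.le, hs₀t⟩

/-- Exponential integrating factor for an absolutely continuous function. -/
theorem integral_exp_mul_sub {k : ℝ → ℝ} {a c t : ℝ} (hk : IntervalIntegrable k volume 0 t) :
    ∫ s in (0 : ℝ)..t, Real.exp (-c * (t - s)) * (k s - c * (a + ∫ x in s..t, k x)) =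
      Real.exp (-c * t) * (a + ∫ x in (0 : ℝ)..t, k x) - a := by
  set F : ℝ → ℝ := fun s => ∫ x in (0 : ℝ)..s, k x with hF
  set E : ℝ → ℝ := fun s => Real.exp (-c * (t - s)) with hE
  have hEd : ∀ s, HasDerivAt E (c * E s) s := by
    intro s
    have h1 : HasDerivAt (fun s : ℝ => -c * (t - s)) (-c * (-1)) s :=
      ((hasDerivAt_id s).const_sub t).const_mul (-c)
    exact h1.exp.congr_deriv (by simp only [hE]; ring)
  have hEc : Continuous E := by simp only [hE]; fun_prop
  have hEac : AbsolutelyContinuousOnInterval E 0 t := by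
    refine ContDiffOn.absolutelyContinuousOnInterval ?_
    have : ContDiff ℝ 1 E := by simp only [hE]; fun_prop
    exact this.contDiffOn
  have hFac : AbsolutelyContinuousOnInterval F 0 t :=
    hk.absolutelyContinuousOnInterval_intervalIntegral left_mem_uIcc
  have hFc : ContinuousOn F (uIcc 0 t) := hFac.continuousOn
  have hFd : ∀ᵐ s, s ∈ uIoc 0 t → E s * deriv F s = E s * k s := by
    filter_upwards [hk.ae_hasDerivAt_integral] with s hs hmem
    rw [(hs (uIoc_subset_uIcc hmem) 0 left_mem_uIcc).deriv]
  have hparts := hEac.integral_mul_deriv_eq_deriv_mul hFac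
  rw [intervalIntegral.integral_congr_ae hFd] at hparts
  simp only [fun s => (hEd s).deriv] at hparts
  have hF0 : F 0 = 0 := by simp [hF]
  have hEt : E t = 1 := by simp [hE]
  have hcE : ∫ s in (0 : ℝ)..t, c * E s = E t - E 0 :=
    intervalIntegral.integral_eq_sub_of_hasDerivAt (fun s _ => hEd s)
      ((continuous_const.mul hEc).intervalIntegrable 0 t)
  have hsplit : ∀ s ∈ uIcc 0 t, E s * (k s - c * (a + ∫ x in s..t, k x)) =
      E s * k s + c * E s * F s - (a + F t) * (c * E s) := by
    intro s hs
    have h0s : IntervalIntegrable k volume 0 s :=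
      hk.mono_set (uIcc_subset_uIcc left_mem_uIcc hs)
    rw [show (∫ x in s..t, k x) = F t - F s from
      (intervalIntegral.integral_interval_sub_left hk h0s).symm]
    ring
  have i₁ : IntervalIntegrable (fun s => E s * k s) volume 0 t :=
    hk.continuousOn_mul hEc.continuousOn
  have i₂ : IntervalIntegrable (fun s => c * E s * F s) volume 0 t :=
    ((continuous_const.mul hEc).continuousOn.mul hFc).intervalIntegrable
  have i₃ : IntervalIntegrable (fun s => (a + F t) * (c * E s)) volume 0 t :=
    (continuous_const.mul (continuous_const.mul hEc)).intervalIntegrable 0 t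
  rw [intervalIntegral.integral_congr hsplit, intervalIntegral.integral_sub (i₁.add i₂) i₃,
    intervalIntegral.integral_add i₁ i₂, intervalIntegral.integral_const_mul, hcE, hparts,
    hF0, hEt]
  simp only [hE, hF, sub_zero]
  ring

end Integration

section Characteristics

variable {D V : Set Pt} {A : (Pt → Pt → ℝ) → Pt → Pt → ℝ} {G : Pt → Pt → ℝ}

theorem integral_along_characteristic (ψ : ℝ → Pt → Pt → ℝ) (t s : ℝ) (r υ : Pt) :
    ∫ x in (0 : ℝ)..(t - s), A (ψ (t - s - x)) (r + s • υ + x • υ) υ =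
      ∫ x in s..t, A (ψ (t - x)) (r + x • υ) υ := by
  have h := intervalIntegral.integral_comp_add_right (a := 0) (b := t - s)
    (fun x => A (ψ (t - x)) (r + x • υ) υ) s
  rw [zero_add, sub_add_cancel] at h
  rw [← h]
  refine intervalIntegral.integral_congr fun x _ => ?_
  simp only [show t - (x + s) = t - s - x by ring, add_smul, add_assoc, add_comm (x • υ)]

/-- The mild equation with advected datum `G` and collision operator `A`. -/
def SolvesMild (D V : Set Pt) (A : (Pt → Pt → ℝ) → Pt → Pt → ℝ) (G : Pt → Pt → ℝ)
    (ψ : ℝ → Pt → Pt → ℝ) : Prop :=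
  ∀ t : ℝ, 0 ≤ t → ∀ r υ : Pt, (r, υ) ∈ D ×ˢ V →
    ψ t r υ = G (r + t • υ) υ + ∫ s in (0 : ℝ)..t, A (ψ (t - s)) (r + s • υ) υ

theorem SolvesMild.along_characteristic {ψ : ℝ → Pt → Pt → ℝ} (h : SolvesMild D V A G ψ)
    {t s : ℝ} {r υ : Pt} (hst : s ≤ t) (hr : r + s • υ ∈ D) (hυ : υ ∈ V) :
    ψ (t - s) (r + s • υ) υ =
      G (r + t • υ) υ + ∫ x in s..t, A (ψ (t - x)) (r + x • υ) υ := by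
  rw [h (t - s) (sub_nonneg.2 hst) _ _ ⟨hr, hυ⟩, integral_along_characteristic,
    add_assoc r, ← add_smul, add_sub_cancel]

theorem SolvesMild.tendsto_left {ψ : ℝ → Pt → Pt → ℝ} (h : SolvesMild D V A G ψ)
    (ho : IsOpen D) {t K : ℝ} (ht : 0 < t) (hK : ∀ s ∈ Icc 0 t, ∀ r υ, |A (ψ s) r υ| ≤ K)
    {r υ : Pt} (hr : r ∈ D) (hυ : υ ∈ V) :
    Tendsto (fun s => ψ (t - s) (r + s • υ) υ) (𝓝[>] 0) (𝓝 (ψ t r υ)) := by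
  rw [h t ht.le r υ ⟨hr, hυ⟩]
  have hlim := (tendsto_integral_lower ht (k := fun s => A (ψ (t - s)) (r + s • υ) υ)
    (fun s hs => hK (t - s) ⟨sub_nonneg.2 hs.2, sub_le_self t hs.1⟩ _ _)).const_add
      (G (r + t • υ) υ)
  refine hlim.congr' ?_
  have hcont : Continuous fun s : ℝ => r + s • υ := by fun_prop
  have hev : ∀ᶠ s : ℝ in 𝓝[>] 0, r + s • υ ∈ D :=
    nhdsWithin_le_nhds ((ho.preimage hcont).mem_nhds (by simpa using hr))
  filter_upwards [hev, Ioo_mem_nhdsGT ht] with s hsD hs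
  exact (h.along_characteristic hs.2.le hsD hυ).symm

/-- A bounded solution whose time slices are measurable is jointly measurable. -/
theorem SolvesMild.jointMeas {ψ : ℝ → Pt → Pt → ℝ} (h : SolvesMild D V A G ψ)
    (ho : IsOpen D) (hV : MeasurableSet V)
    (hmeas : ∀ t, Measurable (Function.uncurry (ψ t)))
    (hzero : ∀ t r υ, (r, υ) ∉ D ×ˢ V → ψ t r υ = 0) {T K : ℝ}
    (hK : ∀ s ∈ Icc 0 T, ∀ r υ, |A (ψ s) r υ| ≤ K) :
    JointMeas fun t r υ => (Ioc 0 T).indicator (fun t => ψ t r υ) t := by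
  let τ : ℕ → ℝ → ℝ := fun n t => ((⌈((n : ℝ) + 1) * t⌉ : ℝ) - 1) / ((n : ℝ) + 1)
  let S : Set (ℝ × Pt × Pt) := Ioc 0 T ×ˢ (D ×ˢ V)
  have hS : MeasurableSet S := measurableSet_Ioc.prod (ho.measurableSet.prod hV)
  let F : ℕ → ℝ × Pt × Pt → ℝ := fun n p =>
    ψ (τ n p.1) (p.2.1 + (p.1 - τ n p.1) • p.2.2) p.2.2
  have hF : ∀ n, Measurable (F n) := by
    intro n
    have hH : Measurable fun q : ℤ × (ℝ × Pt × Pt) =>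
        ψ (((q.1 : ℝ) - 1) / ((n : ℝ) + 1))
          (q.2.2.1 + (q.2.1 - ((q.1 : ℝ) - 1) / ((n : ℝ) + 1)) • q.2.2.2) q.2.2.2 := by
      refine measurable_from_prod_countable_right fun m => ?_
      have hm : Measurable fun p : ℝ × Pt × Pt =>
          ((p.2.1 + (p.1 - ((m : ℝ) - 1) / ((n : ℝ) + 1)) • p.2.2, p.2.2) : Pt × Pt) := by
        fun_prop
      exact (hmeas (((m : ℝ) - 1) / ((n : ℝ) + 1))).comp hm
    have hc : Measurable fun p : ℝ × Pt × Pt => (⌈((n : ℝ) + 1) * p.1⌉, p) :=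
      (Int.measurable_ceil.comp (measurable_fst.const_mul _)).prodMk measurable_id
    exact hH.comp hc
  refine measurable_of_tendsto_metrizable (fun n => (hF n).indicator hS)
    (tendsto_pi_nhds.2 ?_)
  rintro ⟨t, r, υ⟩
  by_cases hp : (t, r, υ) ∈ S
  · obtain ⟨ht, hr, hυ⟩ := hp
    simp only [indicator_of_mem (show (t, r, υ) ∈ S from ⟨ht, hr, hυ⟩), indicator_of_mem ht]
    have hlim := h.tendsto_left ho ht.1
      (fun s hs => hK s ⟨hs.1, hs.2.trans ht.2⟩) hr hυ
    have hτ : Tendsto (fun n => t - τ n t) atTop (𝓝[>] 0) := by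
      have hpos : ∀ n : ℕ, (0 : ℝ) < (n : ℝ) + 1 := fun n => by positivity
      refine tendsto_nhdsWithin_iff.2 ⟨?_, Eventually.of_forall fun n => ?_⟩
      · refine squeeze_zero (fun n => ?_) (fun n => ?_)
          (tendsto_one_div_add_atTop_nhds_zero_nat (𝕜 := ℝ))
        · rw [sub_nonneg, div_le_iff₀ (hpos n)]
          linarith [Int.ceil_lt_add_one (((n : ℝ) + 1) * t)]
        · rw [sub_le_iff_le_add, ← add_div, le_div_iff₀ (hpos n)]
          linarith [Int.le_ceil (((n : ℝ) + 1) * t)]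
      · rw [mem_Ioi, sub_pos, div_lt_iff₀ (hpos n)]
        linarith [Int.ceil_lt_add_one (((n : ℝ) + 1) * t)]
    simpa [Function.comp_def, F] using hlim.comp hτ
  · have h0 : (Ioc 0 T).indicator (fun t => ψ t r υ) t = 0 := by
      by_cases ht : t ∈ Ioc 0 T
      · rw [indicator_of_mem ht]
        exact hzero t r υ fun hm => hp ⟨ht, hm⟩
      · exact indicator_of_notMem ht _
    simp only [indicator_of_notMem hp, h0]
    exact tendsto_const_nhds

theorem SolvesMild.unique {L : ℝ} (hA : IsLipOp A L) (ho : IsOpen D) (hV : MeasurableSet V)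
    {ψ₁ ψ₂ : ℝ → Pt → Pt → ℝ} (h₁ : SolvesMild D V A G ψ₁) (h₂ : SolvesMild D V A G ψ₂)
    (hm₁ : ∀ t, Measurable (Function.uncurry (ψ₁ t)))
    (hm₂ : ∀ t, Measurable (Function.uncurry (ψ₂ t)))
    (hz₁ : ∀ t r υ, (r, υ) ∉ D ×ˢ V → ψ₁ t r υ = 0)
    (hz₂ : ∀ t r υ, (r, υ) ∉ D ×ˢ V → ψ₂ t r υ = 0) {t C : ℝ} (ht : 0 < t)
    (hC₁ : ∀ s ∈ Icc 0 t, ∀ r υ, |ψ₁ s r υ| ≤ C)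
    (hC₂ : ∀ s ∈ Icc 0 t, ∀ r υ, |ψ₂ s r υ| ≤ C) : ψ₁ t = ψ₂ t := by
  have hC0 : 0 ≤ C := (abs_nonneg _).trans (hC₁ 0 ⟨le_rfl, ht.le⟩ 0 0)
  have hlam : 0 < 2 * L + 1 := by linarith [hA.nonneg]
  have hbound : ∀ ψ : ℝ → Pt → Pt → ℝ, (∀ s ∈ Icc 0 t, ∀ r υ, |ψ s r υ| ≤ C) → ∀ s r υ,
      |(Ioc 0 t).indicator (fun s => ψ s r υ) s| ≤ C * Real.exp ((2 * L + 1) * s) := by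
    intro ψ hC s r υ
    by_cases hs : s ∈ Ioc 0 t
    · rw [indicator_of_mem hs]
      exact (hC s ⟨hs.1.le, hs.2⟩ r υ).trans (le_mul_of_one_le_right hC0
        (Real.one_le_exp (mul_nonneg hlam.le hs.1.le)))
    · rw [indicator_of_notMem hs, abs_zero]
      positivity
  have hduh : ∀ ψ : ℝ → Pt → Pt → ℝ, SolvesMild D V A G ψ →
      (∀ t r υ, (r, υ) ∉ D ×ˢ V → ψ t r υ = 0) → ∀ s ∈ Ioc 0 t, ∀ r υ,
      (Ioc 0 t).indicator (fun s => ψ s r υ) s =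
        duhamel D V A G (fun s r υ => (Ioc 0 t).indicator (fun s => ψ s r υ) s) s r υ := by
    intro ψ hψ hz s hs r υ
    rw [indicator_of_mem hs]
    by_cases hm : (r, υ) ∈ D ×ˢ V
    · rw [duhamel_of_mem hs.1.le hm, hψ s hs.1.le r υ hm]
      congr 1
      refine intervalIntegral.integral_congr_Ioo_of_le hs.1.le fun x hx => ?_
      have hx' : s - x ∈ Ioc 0 t :=
        ⟨sub_pos.2 hx.2, (sub_le_self s hx.1.le).trans hs.2⟩
      simp only [indicator_of_mem hx']
    · rw [duhamel_of_not_mem fun hh => hm hh.2, hz s r υ hm]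
  have heq := duhamel_unique (D := D) (V := V) (G := G) (T := t) hA hlam (by linarith)
    (h₁.jointMeas ho hV hm₁ hz₁ fun s hs => hA.bound (hm₁ s) (hC₁ s hs))
    (h₂.jointMeas ho hV hm₂ hz₂ fun s hs => hA.bound (hm₂ s) (hC₂ s hs))
    (hbound ψ₁ hC₁) (hbound ψ₂ hC₂) (hduh ψ₁ h₁ hz₁) (hduh ψ₂ h₂ hz₂)
    (fun s hs r υ => by rw [indicator_of_notMem hs, indicator_of_notMem hs])
  have hmem : t ∈ Ioc 0 t := ⟨ht, le_rfl⟩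
  funext r υ
  simpa only [indicator_of_mem hmem] using congrFun (congrFun (congrFun heq t) r) υ

/-- Removing the integrating factor: from the equation for `A + c` to the one for `A`. -/
theorem solvesMild_of_duhamel_add {L c C lam : ℝ} (hA : IsLipOp A L) (hc : 0 ≤ c)
    (hconv : Convex ℝ D)
    (hAz : ∀ f r υ, (r, υ) ∉ D ×ˢ V → A f r υ = 0)
    (hAh : ∀ (a : ℝ) f r υ, A (fun r υ => a * f r υ) r υ = a * A f r υ)
    (hGz : ∀ r υ, r ∉ D → G r υ = 0)
    {φ : ℝ → Pt → Pt → ℝ} (hφ : JointMeas φ)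
    (hC : ∀ t r υ, |φ t r υ| ≤ C * Real.exp (lam * t))
    (hfix : duhamel D V (fun f r υ => A f r υ + c * f r υ) G φ = φ) :
    SolvesMild D V A G fun t r υ => Real.exp (-c * t) * φ t r υ := by
  intro t ht r υ hm
  obtain ⟨hr, hυ⟩ := hm
  have hφz : ∀ t r υ, (r, υ) ∉ D ×ˢ V → φ t r υ = 0 := fun t r υ hn => by
    rw [← hfix, duhamel_of_not_mem fun hh => hn hh.2]
  have hsol : SolvesMild D V (fun f r υ => A f r υ + c * f r υ) G φ := fun t ht r υ hm => by
    conv_lhs => rw [← hfix, duhamel_of_mem ht hm]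
  set k : ℝ → ℝ := fun s => A (φ (t - s)) (r + s • υ) υ + c * φ (t - s) (r + s • υ) υ with hk
  have hki : IntervalIntegrable k volume 0 t :=
    (hA.add_smul hc).intervalIntegrable hφ hC t 0 t r υ
  have hu : ∀ s ∈ Icc 0 t, φ (t - s) (r + s • υ) υ = G (r + t • υ) υ + ∫ x in s..t, k x := by
    intro s hs
    by_cases hsD : r + s • υ ∈ D
    · exact hsol.along_characteristic hs.2 hsD hυ
    · have hout : ∀ x, s ≤ x → r + x • υ ∉ D := fun x hx hxD =>
        hsD (hconv.ray_mem_of_le hr hxD hs.1 hx)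
      rw [hφz _ _ _ fun hh => hsD hh.1, hGz _ _ (hout t hs.2), zero_add]
      symm
      refine (intervalIntegral.integral_congr (g := fun _ => (0 : ℝ)) fun x hx => ?_).trans
        intervalIntegral.integral_zero
      rw [uIcc_of_le hs.2] at hx
      have hn : (r + x • υ, υ) ∉ D ×ˢ V := fun hh => hout x hx.1 hh.1
      simp only [hk, hAz _ _ _ hn, hφz _ _ _ hn, mul_zero, add_zero]
  have hmain := integral_exp_mul_sub (a := G (r + t • υ) υ) (c := c) hki
  have h0 := hu 0 ⟨le_rfl, ht⟩
  rw [sub_zero, zero_smul, add_zero] at h0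
  rw [← h0] at hmain
  have hcongr : ∫ s in (0 : ℝ)..t,
      A (fun r υ => Real.exp (-c * (t - s)) * φ (t - s) r υ) (r + s • υ) υ =
      Real.exp (-c * t) * φ t r υ - G (r + t • υ) υ := by
    rw [← hmain]
    refine intervalIntegral.integral_congr fun s hs => ?_
    rw [uIcc_of_le ht] at hs
    beta_reduce
    rw [hAh, ← hu s hs]
    simp only [hk, add_sub_cancel_right]
  rw [hcongr]
  ring

end Characteristics

/-- Lemma 2.1 of the paper. Under (H1), for every bounded measurable
`g : D×V → [0,∞)` there exist constants `C₁, C₂ > 0` such that the mild NTE with initial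
datum `g` has a solution `ψ` satisfying `ψ_t[g] ≤ C₁ e^{C₂ t}` on `D×V` for all `t ≥ 0`;
moreover, this solution is unique among solutions that are uniformly bounded on
`D×V×[0,T]` for every `T > 0`. -/
theorem mild_NTE_exists_unique
    (D : Set Pt) (vmin vmax : ℝ) (σs σf : Pt → Pt → ℝ) (πs πf : Pt → Pt → Pt → ℝ)
    (ctx : NTEContext D vmin vmax σs σf πs πf)
    (g : Pt → Pt → ℝ) (hg : BddMeasNN g) :
    ∃ ψ : ℝ → Pt → Pt → ℝ,
      IsMildSolution D (Vel vmin vmax) σs σf πs πf g ψ ∧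
      TimeLocBounded ψ ∧
      (∃ C₁ : ℝ, 0 < C₁ ∧ ∃ C₂ : ℝ, 0 < C₂ ∧
        ∀ t : ℝ, 0 ≤ t → ∀ r υ : Pt, (r, υ) ∈ D ×ˢ Vel vmin vmax →
          ψ t r υ ≤ C₁ * Real.exp (C₂ * t)) ∧
      (∀ ψ' : ℝ → Pt → Pt → ℝ,
        IsMildSolution D (Vel vmin vmax) σs σf πs πf g ψ' → TimeLocBounded ψ' →
        ∀ t : ℝ, 0 ≤ t → ∀ r υ : Pt, ψ' t r υ = ψ t r υ) := by
  obtain ⟨M, hσsM, hσfM, hπsM, hπfM⟩ := ctx.H1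
  obtain ⟨hgm, hg0, Mg, hgM⟩ := hg
  have hM : 0 ≤ M := (ctx.σs_nonneg 0 0).trans (hσsM 0 0)
  have hMg : 0 ≤ Mg := (hg0 0 0).trans (hgM 0 0)
  have hVm := measurableSet_Vel vmin vmax
  have hDm := ctx.D_open.measurableSet
  set V := Vel vmin vmax with hVdef
  have hV0 : ∀ υ ∈ V, υ ≠ 0 := by
    rintro υ hυ rfl
    have := hυ.1
    rw [norm_zero] at this
    exact absurd this (not_le.2 ctx.vmin_pos)
  set A := scatFis D V σs σf πs πf with hAdef
  set L := 2 * (M * (M * volume.real V + 1))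
  have hA : IsLipOp A L := scatFis_isLipOp hM hDm hVm (volume_Vel_lt_top vmin vmax)
    ctx.σs_meas ctx.σf_meas ctx.πs_meas ctx.πf_meas ctx.σs_nonneg ctx.σf_nonneg
    ctx.πs_nonneg ctx.πf_nonneg hσsM hσfM hπsM hπfM
  set G : Pt → Pt → ℝ := fun r υ => D.indicator (fun r => g r υ) r with hGdef
  have hGm : Measurable (Function.uncurry G) := hgm.indicator (measurable_fst hDm)
  have hG0 : ∀ r υ, 0 ≤ G r υ := fun r υ => indicator_nonneg (fun r _ => hg0 r υ) r
  have hGM : ∀ r υ, |G r υ| ≤ Mg := by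
    intro r υ
    rw [abs_of_nonneg (hG0 r υ)]
    exact indicator_apply_le' (fun _ => hgM r υ) fun _ => hMg
  have hmild : ∀ ψ : ℝ → Pt → Pt → ℝ, SolvesMild D V A G ψ ↔
      ∀ t : ℝ, 0 ≤ t → ∀ r υ : Pt, (r, υ) ∈ D ×ˢ V → ψ t r υ = advect D g t r υ +
        ∫ s in (0:ℝ)..t, advect D (A (ψ (t - s))) s r υ := by
    intro ψ
    refine forall₂_congr fun t ht => forall₃_congr fun r υ hm => ?_
    have hυ := hV0 υ hm.2
    have e₁ : advect D g t r υ = G (r + t • υ) υ := by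
      have hiff := lt_exitTime_iff ctx.D_convex ctx.D_open ctx.D_bounded hm.1 hυ ht
      by_cases h : r + t • υ ∈ D
      · exact (if_pos (hiff.2 h)).trans (indicator_of_mem h (fun r => g r υ)).symm
      · exact (if_neg (mt hiff.1 h)).trans (indicator_of_notMem h (fun r => g r υ)).symm
    have e₂ : ∫ s in (0:ℝ)..t, advect D (A (ψ (t - s))) s r υ =
        ∫ s in (0:ℝ)..t, A (ψ (t - s)) (r + s • υ) υ := by
      refine intervalIntegral.integral_congr fun s hs => ?_
      rw [uIcc_of_le ht] at hs
      exact advect_scatFis ctx.D_convex ctx.D_open ctx.D_bounded hm.1 hυ hs.1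
    rw [e₁, e₂]
  have hlam : 0 < 2 * (L + 2 * M) + 1 := by linarith [hA.nonneg]
  set lam := 2 * (L + 2 * M) + 1 with hlamdef
  obtain ⟨φ, hφm, hφ0, hφb, hfix⟩ := exists_duhamel_fixedPoint (D := D) (V := V) (M := Mg)
    hDm hVm (hA.add_smul (c := 2 * M) (by positivity))
    (fun f hf => scatFis_add_nonneg hM ctx.σs_nonneg ctx.σf_nonneg ctx.πs_nonneg
      ctx.πf_nonneg hσsM hσfM hf) hGm hG0 hGM hlam (by linarith)
  set ψ : ℝ → Pt → Pt → ℝ := fun t r υ => Real.exp (-(2 * M) * t) * φ t r υ with hψ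
  have hsol : SolvesMild D V A G ψ := solvesMild_of_duhamel_add hA (by positivity)
    ctx.D_convex (fun _ _ _ => scatFis_of_not_mem) scatFis_const_mul
    (fun r υ hr => indicator_of_notMem hr _) hφm hφb hfix
  have hψ0 : ∀ t r υ, 0 ≤ ψ t r υ := fun t r υ => mul_nonneg (Real.exp_pos _).le (hφ0 t r υ)
  have hψm : ∀ t, Measurable (Function.uncurry (ψ t)) := fun t => (hφm.slice t).const_mul _
  have hψz : ∀ t r υ, (r, υ) ∉ D ×ˢ V → ψ t r υ = 0 := by
    intro t r υ hn
    simp only [hψ]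
    rw [← hfix, duhamel_of_not_mem fun hh => hn hh.2, mul_zero]
  have hψle : ∀ t, 0 ≤ t → ∀ r υ, ψ t r υ ≤ 2 * Mg * Real.exp (lam * t) := by
    intro t ht r υ
    refine le_trans (mul_le_of_le_one_left (hφ0 t r υ) (Real.exp_le_one_iff.2 ?_))
      ((le_abs_self _).trans (hφb t r υ))
    nlinarith
  have hψT : TimeLocBounded ψ := by
    intro T _
    refine ⟨2 * Mg * Real.exp (lam * T), fun t ht r υ => (hψle t ht.1 r υ).trans ?_⟩
    have := ht.2
    gcongr
  refine ⟨ψ, ⟨hψm, hψ0, fun t => ?_, hψz, (hmild ψ).1 hsol⟩, hψT,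
    ⟨2 * Mg + 1, by positivity, lam, hlam, fun t ht r υ _ => ?_⟩, ?_⟩
  · exact ⟨Real.exp (-(2 * M) * t) * (2 * Mg * Real.exp (lam * t)), fun r υ =>
      mul_le_mul_of_nonneg_left ((le_abs_self _).trans (hφb t r υ)) (Real.exp_pos _).le⟩
  · exact (hψle t ht r υ).trans
      (mul_le_mul_of_nonneg_right (by linarith) (Real.exp_pos _).le)
  · rintro ψ' ⟨hm', h0', -, hz', he'⟩ hT' t ht r υ
    have hsol' : SolvesMild D V A G ψ' := (hmild ψ').2 he'
    rcases ht.eq_or_lt with rfl | ht'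
    · by_cases hm : (r, υ) ∈ D ×ˢ V
      · rw [hsol' 0 le_rfl r υ hm, hsol 0 le_rfl r υ hm, intervalIntegral.integral_same,
          intervalIntegral.integral_same]
      · rw [hz' 0 r υ hm, hψz 0 r υ hm]
    · obtain ⟨C, hC⟩ := hψT t ht'
      obtain ⟨C', hC'⟩ := hT' t ht'
      have := hsol'.unique hA ctx.D_open hVm hsol hm' hψm hz' hψz ht' (C := max C' C)
        (fun s hs r υ => by
          rw [abs_of_nonneg (h0' s r υ)]; exact (hC' s hs r υ).trans (le_max_left _ _))
        (fun s hs r υ => by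
          rw [abs_of_nonneg (hψ0 s r υ)]; exact (hC s hs r υ).trans (le_max_right _ _))
      exact congrFun (congrFun this r) υ
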